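/- arXiv:2009.07358 — 4 statements merged into one kernel-verified Lean document; each statement's English description precedes it below -/
import Mathlib

section
/- Let H be a complex Hilbert space, let a ∈ ℝ, and for each t > a let V_t be a bounded linear operator on H such that t ↦ V_t·f is continuous on (a, ∞) for each fixed f ∈ H. Suppose f : (a, ∞) → H is differentiable in the strong sense with f′(t) = V_t·f(t) for all t > a, and suppose t ↦ ‖V_t‖ (operator norm) is integrable on (a, ∞), i.e. ∫_a^∞ ‖V_t‖ dt < ∞. Then the limit lim_{t → ∞} f(t) exists in H. -/
open Filter Set MeasureTheory

/-- Cohen–Powers lemma, first conclusion: if `f′(t) = V_t f(t)`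
on `(a,∞)` with `t ↦ V_t g` continuous for each `g` and `∫_a^∞ ‖V_t‖ dt < ∞`,
then `lim_{t→∞} f(t)` exists. -/
theorem cohen_powers_limit_exists
    {H : Type*} [NormedAddCommGroup H] [InnerProductSpace ℂ H] [CompleteSpace H]
    (a : ℝ) (V : ℝ → H →L[ℂ] H)
    (hVcont : ∀ g : H, ContinuousOn (fun t => V t g) (Set.Ioi a))
    (f : ℝ → H)
    (hODE : ∀ t ∈ Set.Ioi a, HasDerivAt f (V t (f t)) t)
    (hint : MeasureTheory.IntegrableOn (fun t => ‖V t‖) (Set.Ioi a)) :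
    ∃ L : H, Filter.Tendsto f Filter.atTop (nhds L) := by
  have hcont : ContinuousOn f (Ioi a) := fun t ht =>
    (hODE t ht).continuousAt.continuousWithinAt
  have hmeas : AEStronglyMeasurable (fun t => V t (f t)) (volume.restrict (Ioi a)) := by
    refine (aestronglyMeasurable_deriv f _).congr ?_
    filter_upwards [ae_restrict_mem measurableSet_Ioi] with t ht
    exact (hODE t ht).deriv
  -- a bound on `f` over a subset gives integrability of the derivative there
  have hintbd : ∀ (s : Set ℝ) (M : ℝ), MeasurableSet s → s ⊆ Ioi a → (∀ t ∈ s, ‖f t‖ ≤ M) →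
      IntegrableOn (fun t => V t (f t)) s := by
    intro s M hs hsa hM
    refine ((hint.mono_set hsa).mul_const M).mono' (hmeas.mono_set hsa) ?_
    filter_upwards [ae_restrict_mem hs] with t ht
    exact ((V t).le_opNorm _).trans (mul_le_mul_of_nonneg_left (hM t ht) (norm_nonneg _))
  -- choose `b` with small tail
  obtain ⟨b, hab, hb⟩ : ∃ b, a < b ∧ ∀ t, b ≤ t → ∫ s in b..t, ‖V s‖ ≤ 1 / 2 := by
    have hlim := intervalIntegral_tendsto_integral_Ioi (a + 1)
      (hint.mono_set (Ioi_subset_Ioi (by linarith : a ≤ a + 1))) tendsto_id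
    obtain ⟨N, hN⟩ := Metric.cauchySeq_iff.1 hlim.cauchySeq (1 / 2) (by norm_num)
    have hb1 : a + 1 ≤ max N (a + 1) := le_max_right _ _
    refine ⟨max N (a + 1), by linarith, fun t ht => ?_⟩
    have h := hN t ((le_max_left _ _).trans ht) (max N (a + 1)) (le_max_left _ _)
    have hi : ∀ x y, a + 1 ≤ x → x ≤ y → IntervalIntegrable (fun s => ‖V s‖) volume x y :=
      fun x y hx hxy => (intervalIntegrable_iff_integrableOn_Ioc_of_le hxy).2
        (hint.mono_set fun z hz => by
          have := hz.1
          simp only [mem_Ioi]; linarith)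
    simp only [id] at h
    rw [Real.dist_eq, intervalIntegral.integral_interval_sub_left
      (hi _ _ le_rfl (hb1.trans ht)) (hi _ _ le_rfl hb1)] at h
    exact ((le_abs_self _).trans_lt h).le
  have hbound : ∀ T, b ≤ T → ‖f T‖ ≤ 2 * ‖f b‖ := by
    intro T hT
    have hsub : Icc b T ⊆ Ioi a := fun z hz => hab.trans_le hz.1
    obtain ⟨m, hm, hmax⟩ := isCompact_Icc.exists_isMaxOn (nonempty_Icc.2 hT)
      (hcont.mono hsub).norm
    have hM : ∀ t ∈ Icc b T, ‖f t‖ ≤ ‖f m‖ := fun t ht => hmax ht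
    have hsubm : Ioc b m ⊆ Icc b T := fun z hz => ⟨hz.1.le, hz.2.trans hm.2⟩
    have hftc : ∫ s in b..m, V s (f s) = f m - f b := by
      refine intervalIntegral.integral_eq_sub_of_hasDerivAt (fun x hx => ?_) ?_
      · rw [uIcc_of_le hm.1] at hx
        exact hODE x (hab.trans_le hx.1)
      · exact (intervalIntegrable_iff_integrableOn_Ioc_of_le hm.1).2
          (hintbd _ ‖f m‖ measurableSet_Ioc (hsubm.trans hsub) fun t ht => hM t (hsubm ht))
    have hle : ‖∫ s in b..m, V s (f s)‖ ≤ ∫ s in b..m, ‖V s‖ * ‖f m‖ := by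
      refine intervalIntegral.norm_integral_le_of_norm_le hm.1 (ae_of_all _ fun t ht => ?_) ?_
      · exact ((V t).le_opNorm _).trans
          (mul_le_mul_of_nonneg_left (hM t (hsubm ht)) (norm_nonneg _))
      · exact (intervalIntegrable_iff_integrableOn_Ioc_of_le hm.1).2
          ((hint.mono_set (hsubm.trans hsub)).mul_const _)
    rw [hftc, intervalIntegral.integral_mul_const] at hle
    have h1 := mul_le_mul_of_nonneg_right (hb m hm.1) (norm_nonneg (f m))
    have h2 := norm_sub_norm_le (f m) (f b)
    have h3 := hM T ⟨hT, le_rfl⟩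
    linarith
  exact ⟨_, tendsto_limUnder_of_hasDerivAt_of_integrableOn_Ioi
    (fun x hx => hODE x (hab.trans hx))
    (hintbd (Ioi b) _ measurableSet_Ioi (Ioi_subset_Ioi hab.le) fun t ht => hbound t (le_of_lt ht))⟩
end

section
/- Let H be a complex Hilbert space, let a ∈ ℝ, and for each t > a let V_t be a bounded linear operator on H such that t ↦ V_t·f is continuous on (a, ∞) for each fixed f ∈ H. Suppose f : (a, ∞) → H is differentiable in the strong sense with f′(t) = V_t·f(t) for all t > a, and ∫_a^∞ ‖V_t‖ dt < ∞. If lim_{t → ∞} f(t) = 0, then f(t) = 0 for all t > a. -/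
open Filter Set MeasureTheory

/-- Cohen–Powers lemma, rigidity conclusion: if `f′(t) = V_t f(t)`
on `(a,∞)` with `t ↦ V_t g` continuous for each `g`, `∫_a^∞ ‖V_t‖ dt < ∞`, and
`f(t) → 0` as `t → ∞`, then `f ≡ 0` on `(a,∞)`. -/
theorem cohen_powers_rigidity
    {H : Type*} [NormedAddCommGroup H] [InnerProductSpace ℂ H] [CompleteSpace H]
    (a : ℝ) (V : ℝ → H →L[ℂ] H)
    (hVcont : ∀ g : H, ContinuousOn (fun t => V t g) (Set.Ioi a))
    (f : ℝ → H)
    (hODE : ∀ t ∈ Set.Ioi a, HasDerivAt f (V t (f t)) t)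
    (hint : MeasureTheory.IntegrableOn (fun t => ‖V t‖) (Set.Ioi a))
    (hlim : Filter.Tendsto f Filter.atTop (nhds 0)) :
    ∀ t ∈ Set.Ioi a, f t = 0 := by
  have hfc : ContinuousOn f (Ioi a) := fun t ht => (hODE t ht).continuousAt.continuousWithinAt
  -- a tail with small integral
  obtain ⟨T, hTa, hT⟩ : ∃ T, a < T ∧ ∫ t in Ioi T, ‖V t‖ < 1 := by
    have h1 := intervalIntegral_tendsto_integral_Ioi a hint tendsto_id
    have h2 := (h1.eventually (lt_mem_nhds (sub_one_lt _))).and (eventually_gt_atTop a)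
    obtain ⟨T, h3, h4⟩ := h2.exists
    refine ⟨T, h4, ?_⟩
    have h5 := intervalIntegral.integral_interval_add_Ioi hint (hint.mono_set (Ioi_subset_Ioi h4.le))
    simp only [id] at h3
    linarith
  -- vanishing on the tail
  have tail : ∀ t ∈ Ici T, f t = 0 := by
    by_contra! hne
    obtain ⟨x0, hx0, hfx0⟩ := hne
    have hTs : Ici T ⊆ Ioi a := fun t ht => lt_of_lt_of_le hTa ht
    have hev : ∀ᶠ x in cocompact ℝ ⊓ 𝓟 (Ici T), ‖f x‖ ≤ ‖f x0‖ := by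
      rw [eventually_inf_principal, cocompact_eq_atBot_atTop, eventually_sup]
      constructor
      · filter_upwards [eventually_lt_atBot T] with x hx hx'
        exact absurd hx (not_lt.mpr hx')
      · have h := hlim.norm
        rw [norm_zero] at h
        filter_upwards [h.eventually (gt_mem_nhds (norm_pos_iff.mpr hfx0))] with x hx _
        exact hx.le
    obtain ⟨m, hm, hmax⟩ := ContinuousOn.exists_isMaxOn' (hfc.mono hTs).norm isClosed_Ici hx0 hev
    have hmpos : 0 < ‖f m‖ := (norm_pos_iff.mpr hfx0).trans_le (hmax hx0)
    have hmT : Ioi m ⊆ Ioi T := Ioi_subset_Ioi hm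
    have hma : Ioi m ⊆ Ioi a := hmT.trans (Ioi_subset_Ioi hTa.le)
    have hb : ∀ t ∈ Ioi m, ‖V t (f t)‖ ≤ ‖V t‖ * ‖f m‖ := fun t ht =>
      ((V t).le_opNorm _).trans
        (mul_le_mul_of_nonneg_left (hmax (mem_Ici.mpr (le_of_lt (hmT ht)))) (norm_nonneg _))
    have hVi : IntegrableOn (fun t => ‖V t‖ * ‖f m‖) (Ioi m) := (hint.mono_set hma).mul_const _
    have hi : IntegrableOn (fun t => V t (f t)) (Ioi m) := by
      refine Integrable.mono' hVi ?_ ((ae_restrict_mem measurableSet_Ioi).mono hb)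
      refine (stronglyMeasurable_deriv f).aestronglyMeasurable.congr ?_
      filter_upwards [ae_restrict_mem measurableSet_Ioi] with t ht
      exact (hODE t (hma ht)).deriv
    have key := integral_Ioi_of_hasDerivAt_of_tendsto (hODE m (hTs hm)).continuousAt.continuousWithinAt
      (fun t ht => hODE t (hma ht)) hi hlim
    have h1 : ‖f m‖ ≤ ∫ t in Ioi m, ‖V t‖ * ‖f m‖ := by
      calc ‖f m‖ = ‖∫ t in Ioi m, V t (f t)‖ := by rw [key]; simp
        _ ≤ _ := norm_integral_le_of_norm_le hVi ((ae_restrict_mem measurableSet_Ioi).mono hb)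
    rw [integral_mul_const] at h1
    have h2 : ∫ t in Ioi m, ‖V t‖ ≤ ∫ t in Ioi T, ‖V t‖ :=
      setIntegral_mono_set (hint.mono_set (Ioi_subset_Ioi hTa.le))
        (Eventually.of_forall fun _ => norm_nonneg _) hmT.eventuallyLE
    nlinarith
  -- backward uniqueness
  intro t ht
  rcases le_or_gt T t with h | h
  · exact tail t h
  have hsub : Icc t T ⊆ Ioi a := fun s hs => lt_of_lt_of_le ht hs.1
  obtain ⟨K, hK⟩ : ∃ K, ∀ s : Icc t T, ‖V s‖ ≤ K := by
    apply banach_steinhaus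
    intro g
    obtain ⟨C, hC⟩ := isCompact_Icc.exists_bound_of_continuousOn ((hVcont g).mono hsub)
    exact ⟨C, fun s => hC s s.2⟩
  have hd : ∀ x ∈ Icc (-T) (-t), HasDerivAt (fun s => f (-s)) (-(V (-x) (f (-x)))) x := by
    intro x hx
    have h1 := hODE (-x) (hsub ⟨by linarith [hx.2], by linarith [hx.1]⟩)
    simpa [Function.comp_def] using h1.scomp x (hasDerivAt_neg x)
  have := eq_zero_of_abs_deriv_le_mul_abs_self_of_eq_zero_right (K := K)
    (f := fun s => f (-s)) (a := -T) (b := -t)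
    (fun x hx => (hd x hx).continuousAt.continuousWithinAt)
    (fun x hx => (hd x (Ico_subset_Icc_self hx)).hasDerivWithinAt)
    (by simpa using tail T self_mem_Ici)
    (fun x hx => by
      rw [norm_neg]
      exact (V (-x)).le_of_opNorm_le (hK ⟨-x, by linarith [hx.2], by linarith [hx.1]⟩) _)
    (-t) ⟨by linarith, le_rfl⟩
  simpa using this
end

section
/- Let θ ∈ ℝ. (i) If z = (z₁, z₂) ∈ ℂ² and w = (w₁, w₂) ∈ ℂ² both satisfy the boundary condition z₁·sin θ + z₂·cos θ = 0 and w₁·sin θ + w₂·cos θ = 0, then z₂·conj(w₁) − z₁·conj(w₂) = 0. (ii) Conversely, if z = (z₁, z₂) ∈ ℂ² is nonzero and satisfies z₂·conj(z₁) − z₁·conj(z₂) = 0 (equivalently, one of z₁, z₂ is a real multiple of the other), then there exists θ ∈ [0, π) with z₁·sin θ + z₂·cos θ = 0. -/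
/-- (i) If `z, w ∈ ℂ²` both satisfy the boundary condition
`·₁ sin θ + ·₂ cos θ = 0`, then `z₂ conj w₁ − z₁ conj w₂ = 0`.
(ii) Conversely, a nonzero `z ∈ ℂ²` with `z₂ conj z₁ − z₁ conj z₂ = 0` satisfies
`z₁ sin θ + z₂ cos θ = 0` for some `θ ∈ [0, π)`. -/
theorem boundary_condition_symmetry
    (θ : ℝ) :
    (∀ z₁ z₂ w₁ w₂ : ℂ,
      z₁ * (Real.sin θ : ℂ) + z₂ * (Real.cos θ : ℂ) = 0 →
      w₁ * (Real.sin θ : ℂ) + w₂ * (Real.cos θ : ℂ) = 0 →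
      z₂ * (starRingEnd ℂ) w₁ - z₁ * (starRingEnd ℂ) w₂ = 0) ∧
    (∀ z₁ z₂ : ℂ, (z₁, z₂) ≠ (0, 0) →
      z₂ * (starRingEnd ℂ) z₁ - z₁ * (starRingEnd ℂ) z₂ = 0 →
      ∃ θ' : ℝ, θ' ∈ Set.Ico (0 : ℝ) Real.pi ∧
        z₁ * (Real.sin θ' : ℂ) + z₂ * (Real.cos θ' : ℂ) = 0) := by
  constructor
  · intro z₁ z₂ w₁ w₂ hz hw
    have hw' := congrArg (starRingEnd ℂ) hw
    simp only [map_add, map_mul, Complex.conj_ofReal, map_zero] at hw'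
    have hsc : (Real.sin θ : ℂ) ^ 2 + (Real.cos θ : ℂ) ^ 2 = 1 := by
      exact_mod_cast Real.sin_sq_add_cos_sq θ
    linear_combination
      (-(z₂ * (starRingEnd ℂ) w₁ - z₁ * (starRingEnd ℂ) w₂)) * hsc
      + (Real.sin θ : ℂ) * (z₂ * hw' - (starRingEnd ℂ) w₂ * hz)
      + (Real.cos θ : ℂ) * ((starRingEnd ℂ) w₁ * hz - z₁ * hw')
  · intro z₁ z₂ _ h
    by_cases h1 : z₁ = 0
    · refine ⟨Real.pi / 2, ⟨by positivity, by linarith [Real.pi_pos]⟩, ?_⟩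
      rw [h1, Real.cos_pi_div_two]
      simp
    · have h1' : (starRingEnd ℂ) z₁ ≠ 0 := by simpa using h1
      have hr : (starRingEnd ℂ) (z₂ / z₁) = z₂ / z₁ := by
        rw [map_div₀, div_eq_div_iff h1' h1]
        linear_combination -h
      obtain ⟨r, hr⟩ := Complex.conj_eq_iff_real.mp hr
      have hz : z₂ = r * z₁ := by rw [← hr]; field_simp
      have key : Real.sin (Real.arctan (-r)) + r * Real.cos (Real.arctan (-r)) = 0 := by
        rw [Real.sin_arctan, Real.cos_arctan]
        ring
      have hlt := Real.arctan_lt_pi_div_two (-r)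
      have hgt := Real.neg_pi_div_two_lt_arctan (-r)
      have hpi := Real.pi_pos
      have fin : ∀ t : ℝ, Real.sin t + r * Real.cos t = 0 →
          z₁ * (Real.sin t : ℂ) + z₂ * (Real.cos t : ℂ) = 0 := by
        intro t ht
        have ht' : (Real.sin t : ℂ) + r * (Real.cos t : ℂ) = 0 := by exact_mod_cast ht
        rw [hz]
        linear_combination z₁ * ht'
      by_cases h0 : 0 ≤ Real.arctan (-r)
      · exact ⟨_, ⟨h0, by linarith⟩, fin _ key⟩
      · push Not at h0
        refine ⟨Real.arctan (-r) + Real.pi, ⟨by linarith, by linarith⟩, fin _ ?_⟩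
        rw [Real.sin_add_pi, Real.cos_add_pi]
        linarith
end

section
/- Let X > 0 and let c̃, a, b, ψ₁, ψ₂ : (0, X] → ℂ be measurable functions that are (absolutely) integrable on (0, X). Suppose g = (g₁, g₂) : (0, X] → ℂ² is continuous, is differentiable almost everywhere, and satisfies the first-order system g₁′(x) = −c̃(x)·g₁(x) + (a(x) + b(x))·g₂(x) + ψ₂(x) and g₂′(x) = c̃(x)·g₂(x) + (a(x) − b(x))·g₁(x) − ψ₁(x) in the integrated (absolutely continuous) sense on every compact subinterval of (0, X]. Then the limit lim_{x → 0⁺} g(x) exists in ℂ²; i.e., g extends continuously to [0, X]. -/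
open Filter Set MeasureTheory intervalIntegral

lemma bv_limit_aux (X δ M : ℝ) (hδ : 0 < δ) (hδX : δ ≤ X) (g F : ℝ → ℂ) (B : ℝ → ℝ)
    (hFm : AEStronglyMeasurable F (volume.restrict (Ioc 0 δ)))
    (hB : IntegrableOn B (Ioc 0 δ))
    (hFB : ∀ y ∈ Ioc 0 δ, ‖F y‖ ≤ B y)
    (hsys : ∀ x, 0 < x → x ≤ δ → g δ - g x = ∫ y in x..δ, F y) :
    ∃ l : ℂ, Tendsto g (nhdsWithin 0 (Ioc 0 X)) (nhds l) := by
  have hF : IntegrableOn F (Ioc 0 δ) :=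
    Integrable.mono' hB hFm ((ae_restrict_iff' measurableSet_Ioc).2 (ae_of_all _ hFB))
  have hF' : IntegrableOn F (uIcc 0 δ) := by
    rw [uIcc_of_le hδ.le, integrableOn_Icc_iff_integrableOn_Ioc]; exact hF
  have hcont := (intervalIntegral.continuousOn_primitive_interval_left hF') 0 left_mem_uIcc
  rw [uIcc_of_le hδ.le] at hcont
  have h2 : Tendsto (fun x => g δ - ∫ y in x..δ, F y) (nhdsWithin 0 (Icc 0 δ))
      (nhds (g δ - ∫ y in (0:ℝ)..δ, F y)) := tendsto_const_nhds.sub hcont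
  refine ⟨g δ - ∫ y in (0:ℝ)..δ, F y, ?_⟩
  · have h3 : Tendsto (fun x => g δ - ∫ y in x..δ, F y) (nhdsWithin 0 (Ioi 0))
        (nhds (g δ - ∫ y in (0:ℝ)..δ, F y)) := by
      rw [← nhdsWithin_Ioc_eq_nhdsGT hδ]
      exact h2.mono_left (nhdsWithin_mono _ Ioc_subset_Icc_self)
    refine Tendsto.mono_left ?_ (nhdsWithin_mono _ Ioc_subset_Ioi_self)
    refine h3.congr' ?_
    filter_upwards [Ioc_mem_nhdsGT hδ] with x hx
    rw [← hsys x hx.1 hx.2]; ring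

lemma bv_bound_aux (δ M x : ℝ) (hx : 0 < x) (hxδ : x ≤ δ) (hM : 0 ≤ M) (g F : ℝ → ℂ)
    (K P : ℝ → ℝ) (hK0 : ∀ y, 0 ≤ K y) (hP0 : ∀ y, 0 ≤ P y)
    (hK : IntegrableOn K (Ioc 0 δ)) (hP : IntegrableOn P (Ioc 0 δ))
    (hF : ∀ y ∈ Ioc x δ, ‖F y‖ ≤ M * K y + P y)
    (hsys : g δ - g x = ∫ y in x..δ, F y) :
    ‖g x‖ ≤ ‖g δ‖ + (M * (∫ y in (0:ℝ)..δ, K y) + ∫ y in (0:ℝ)..δ, P y) := by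
  have hδ : 0 ≤ δ := hx.le.trans hxδ
  have hKP : IntegrableOn (fun y => M * K y + P y) (Ioc 0 δ) := (hK.const_mul M).add hP
  have hKi : IntervalIntegrable K volume 0 δ := (intervalIntegrable_iff_integrableOn_Ioc_of_le hδ).2 hK
  have hPi : IntervalIntegrable P volume 0 δ := (intervalIntegrable_iff_integrableOn_Ioc_of_le hδ).2 hP
  have hKPi : IntervalIntegrable (fun y => M * K y + P y) volume 0 δ :=
    (intervalIntegrable_iff_integrableOn_Ioc_of_le hδ).2 hKP
  have h1 : ‖∫ y in x..δ, F y‖ ≤ ∫ y in x..δ, (M * K y + P y) := by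
    refine intervalIntegral.norm_integral_le_of_norm_le hxδ (ae_of_all _ hF) ?_
    exact (intervalIntegrable_iff_integrableOn_Ioc_of_le hxδ).2
      (hKP.mono_set (Ioc_subset_Ioc_left hx.le))
  have h2 : ∫ y in x..δ, (M * K y + P y) ≤ ∫ y in (0:ℝ)..δ, (M * K y + P y) := by
    refine intervalIntegral.integral_mono_interval hx.le hxδ le_rfl (ae_of_all _ fun y => ?_) hKPi
    exact add_nonneg (mul_nonneg hM (hK0 y)) (hP0 y)
  rw [intervalIntegral.integral_add (hKi.const_mul M) hPi, intervalIntegral.integral_const_mul] at h2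
  have h3 : g x = g δ - ∫ y in x..δ, F y := by rw [← hsys]; ring
  rw [h3]
  exact (norm_sub_le _ _).trans (by linarith)

/-- If `g = (g₁,g₂)` is continuous on `(0,X]` and satisfies, in the
integrated (absolutely continuous) sense, the system
`g₁′ = −c̃ g₁ + (a+b) g₂ + ψ₂`, `g₂′ = c̃ g₂ + (a−b) g₁ − ψ₁`
with `c̃, a, b, ψ₁, ψ₂` integrable on `(0,X)`, then `lim_{x→0⁺} g(x)` exists;
i.e. `g` extends continuously to `[0,X]`. -/
theorem boundary_values_at_singularity_exist
    (X : ℝ) (hX : 0 < X)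
    (ctilde a b ψ₁ ψ₂ : ℝ → ℂ)
    (hc : MeasureTheory.IntegrableOn ctilde (Set.Ioc 0 X))
    (ha : MeasureTheory.IntegrableOn a (Set.Ioc 0 X))
    (hb : MeasureTheory.IntegrableOn b (Set.Ioc 0 X))
    (hψ₁ : MeasureTheory.IntegrableOn ψ₁ (Set.Ioc 0 X))
    (hψ₂ : MeasureTheory.IntegrableOn ψ₂ (Set.Ioc 0 X))
    (g₁ g₂ : ℝ → ℂ)
    (hg₁c : ContinuousOn g₁ (Set.Ioc 0 X)) (hg₂c : ContinuousOn g₂ (Set.Ioc 0 X))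
    (hsys₁ : ∀ x₁ x₂ : ℝ, 0 < x₁ → x₁ ≤ x₂ → x₂ ≤ X →
      g₁ x₂ - g₁ x₁ = ∫ y in x₁..x₂, (-(ctilde y) * g₁ y + (a y + b y) * g₂ y + ψ₂ y))
    (hsys₂ : ∀ x₁ x₂ : ℝ, 0 < x₁ → x₁ ≤ x₂ → x₂ ≤ X →
      g₂ x₂ - g₂ x₁ = ∫ y in x₁..x₂, (ctilde y * g₂ y + (a y - b y) * g₁ y - ψ₁ y)) :
    ∃ l : ℂ × ℂ, Filter.Tendsto (fun x => (g₁ x, g₂ x))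
      (nhdsWithin 0 (Set.Ioc 0 X)) (nhds l) := by
  set K : ℝ → ℝ := fun y => ‖ctilde y‖ + ‖a y‖ + ‖b y‖ with hKdef
  set P : ℝ → ℝ := fun y => ‖ψ₁ y‖ + ‖ψ₂ y‖ with hPdef
  have hK0 : ∀ y, 0 ≤ K y := fun y => by positivity
  have hP0 : ∀ y, 0 ≤ P y := fun y => by positivity
  have hK : IntegrableOn K (Ioc 0 X) := (hc.norm.add ha.norm).add hb.norm
  have hP : IntegrableOn P (Ioc 0 X) := hψ₁.norm.add hψ₂.norm
  -- pointwise bounds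
  have hF1 : ∀ y M, ‖g₁ y‖ + ‖g₂ y‖ ≤ M →
      ‖-(ctilde y) * g₁ y + (a y + b y) * g₂ y + ψ₂ y‖ ≤ M * K y + P y := by
    intro y M hM
    have e1 : ‖-(ctilde y) * g₁ y‖ ≤ ‖ctilde y‖ * M := by
      rw [norm_mul, norm_neg]
      exact mul_le_mul_of_nonneg_left (by linarith [norm_nonneg (g₂ y)]) (norm_nonneg _)
    have e2 : ‖(a y + b y) * g₂ y‖ ≤ (‖a y‖ + ‖b y‖) * M := by
      rw [norm_mul]
      exact mul_le_mul (norm_add_le _ _) (by linarith [norm_nonneg (g₁ y)]) (norm_nonneg _)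
        (by positivity)
    have e3 := norm_add₃_le (a := -(ctilde y) * g₁ y) (b := (a y + b y) * g₂ y) (c := ψ₂ y)
    simp only [hKdef, hPdef]
    nlinarith [norm_nonneg (ψ₁ y)]
  have hF2 : ∀ y M, ‖g₁ y‖ + ‖g₂ y‖ ≤ M →
      ‖ctilde y * g₂ y + (a y - b y) * g₁ y - ψ₁ y‖ ≤ M * K y + P y := by
    intro y M hM
    have e1 : ‖ctilde y * g₂ y‖ ≤ ‖ctilde y‖ * M := by
      rw [norm_mul]
      exact mul_le_mul_of_nonneg_left (by linarith [norm_nonneg (g₁ y)]) (norm_nonneg _)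
    have e2 : ‖(a y - b y) * g₁ y‖ ≤ (‖a y‖ + ‖b y‖) * M := by
      rw [norm_mul]
      exact mul_le_mul (norm_sub_le _ _) (by linarith [norm_nonneg (g₂ y)]) (norm_nonneg _)
        (by positivity)
    have e3 := norm_sub_le (ctilde y * g₂ y + (a y - b y) * g₁ y) (ψ₁ y)
    have e4 := norm_add_le (ctilde y * g₂ y) ((a y - b y) * g₁ y)
    simp only [hKdef, hPdef]
    nlinarith [norm_nonneg (ψ₂ y)]
  -- choice of δ
  obtain ⟨δ, hδ, hδX, hKδ⟩ : ∃ δ, 0 < δ ∧ δ ≤ X ∧ ∫ y in (0:ℝ)..δ, K y < 1 / 4 := by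
    have hK' : IntegrableOn K (uIcc 0 X) := by
      rw [uIcc_of_le hX.le, integrableOn_Icc_iff_integrableOn_Ioc]; exact hK
    have hcont := (intervalIntegral.continuousOn_primitive_interval hK') 0 left_mem_uIcc
    rw [uIcc_of_le hX.le] at hcont
    have h3 : Tendsto (fun x => ∫ y in (0:ℝ)..x, K y) (nhdsWithin 0 (Ioi 0))
        (nhds (∫ y in (0:ℝ)..0, K y)) := by
      rw [← nhdsWithin_Ioc_eq_nhdsGT hX]
      exact Tendsto.mono_left hcont (nhdsWithin_mono _ Ioc_subset_Icc_self)
    rw [intervalIntegral.integral_same] at h3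
    have h4 := h3.eventually (gt_mem_nhds (show (0:ℝ) < 1 / 4 by norm_num))
    obtain ⟨δ, h5, h6⟩ := (h4.and (Ioc_mem_nhdsGT hX)).exists
    exact ⟨δ, h6.1, h6.2, h5⟩
  have hsub : Ioc 0 δ ⊆ Ioc 0 X := Ioc_subset_Ioc_right hδX
  have hKδi := hK.mono_set hsub
  have hPδi := hP.mono_set hsub
  set C : ℝ := 2 * (‖g₁ δ‖ + ‖g₂ δ‖ + 2 * ∫ y in (0:ℝ)..δ, P y) with hC
  have hbound : ∀ ε ∈ Ioc 0 δ, ‖g₁ ε‖ + ‖g₂ ε‖ ≤ C := by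
    intro ε hε
    have hsub2 : Icc ε δ ⊆ Ioc 0 X := fun y hy => ⟨hε.1.trans_le hy.1, hy.2.trans hδX⟩
    have hcN : ContinuousOn (fun y => ‖g₁ y‖ + ‖g₂ y‖) (Icc ε δ) :=
      ((hg₁c.mono hsub2).norm).add ((hg₂c.mono hsub2).norm)
    obtain ⟨x, hx, hmax⟩ := isCompact_Icc.exists_isMaxOn ⟨ε, left_mem_Icc.2 hε.2⟩ hcN
    set M := ‖g₁ x‖ + ‖g₂ x‖ with hM
    have hM0 : 0 ≤ M := by positivity
    have hle : ∀ y ∈ Icc ε δ, ‖g₁ y‖ + ‖g₂ y‖ ≤ M := fun y hy => hmax hy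
    have hx0 : 0 < x := hε.1.trans_le hx.1
    have b1 := bv_bound_aux δ M x hx0 hx.2 hM0 g₁ _ K P hK0 hP0 hKδi hPδi
      (fun y hy => hF1 y M (hle y ⟨hx.1.trans hy.1.le, hy.2⟩)) (hsys₁ x δ hx0 hx.2 hδX)
    have b2 := bv_bound_aux δ M x hx0 hx.2 hM0 g₂ _ K P hK0 hP0 hKδi hPδi
      (fun y hy => hF2 y M (hle y ⟨hx.1.trans hy.1.le, hy.2⟩)) (hsys₂ x δ hx0 hx.2 hδX)
    have b3 : M * (∫ y in (0:ℝ)..δ, K y) ≤ M * (1 / 4) :=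
      mul_le_mul_of_nonneg_left hKδ.le hM0
    have b4 := hle ε (left_mem_Icc.2 hε.2)
    rw [hC]
    linarith
  have hB : IntegrableOn (fun y => C * K y + P y) (Ioc 0 δ) := (hKδi.const_mul C).add hPδi
  have mg1 := (hg₁c.mono hsub).aestronglyMeasurable measurableSet_Ioc (μ := volume)
  have mg2 := (hg₂c.mono hsub).aestronglyMeasurable measurableSet_Ioc (μ := volume)
  have mc := (hc.mono_set hsub).aestronglyMeasurable
  have ma := (ha.mono_set hsub).aestronglyMeasurable
  have mb := (hb.mono_set hsub).aestronglyMeasurable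
  have m1 := (hψ₁.mono_set hsub).aestronglyMeasurable
  have m2 := (hψ₂.mono_set hsub).aestronglyMeasurable
  obtain ⟨l₁, hl₁⟩ := bv_limit_aux X δ C hδ hδX g₁ _ _
    (((mc.neg.mul mg1).add ((ma.add mb).mul mg2)).add m2) hB
    (fun y hy => hF1 y C (hbound y hy)) (fun x hx hxδ => hsys₁ x δ hx hxδ hδX)
  obtain ⟨l₂, hl₂⟩ := bv_limit_aux X δ C hδ hδX g₂ _ _
    (((mc.mul mg2).add ((ma.sub mb).mul mg1)).sub m1) hB
    (fun y hy => hF2 y C (hbound y hy)) (fun x hx hxδ => hsys₂ x δ hx hxδ hδX)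
  exact ⟨(l₁, l₂), hl₁.prodMk_nhds hl₂⟩
end
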